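/- arXiv:2204.08693 — 4 statements merged into one kernel-verified Lean document; each statement's English description precedes it below -/
import Mathlib

section
/- The second-order SSP Runge–Kutta scheme preserves the strong stability of the forward Euler step: if ‖w + Δt·N(w)‖ ≤ ‖w‖ for every w ∈ E, then one step of the scheme satisfies ‖v_new‖ ≤ ‖v‖ for every v ∈ E. -/
/-- The second-order SSP Runge–Kutta scheme preserves the strong stability of the forward
Euler step: if `‖w + Δt·N(w)‖ ≤ ‖w‖` for every `w`, then one step
`v¹ = v + Δt·N(v)`, `v_new = (1/2)·v + (1/2)·v¹ + (1/2)·Δt·N(v¹)`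
satisfies `‖v_new‖ ≤ ‖v‖`. -/
theorem ssp2_strong_stability {E : Type*} [NormedAddCommGroup E] [NormedSpace ℝ E]
    (N : E → E) (Δt : ℝ) (hΔt : 0 ≤ Δt)
    (hEuler : ∀ w : E, ‖w + Δt • N w‖ ≤ ‖w‖) :
    ∀ v : E,
      ‖(1 / 2 : ℝ) • v + (1 / 2 : ℝ) • (v + Δt • N v) +
          ((1 / 2 : ℝ) * Δt) • N (v + Δt • N v)‖ ≤ ‖v‖ := by
  intro v
  have hv := hEuler v
  have hv₁ := hEuler (v + Δt • N v)
  rw [add_assoc, mul_smul, ← smul_add]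
  calc
    _ ≤ ‖(1 / 2 : ℝ) • v‖ + ‖(1 / 2 : ℝ) • (v + Δt • N v + Δt • N (v + Δt • N v))‖ :=
      norm_add_le _ _
    _ = 1 / 2 * ‖v‖ + 1 / 2 * ‖v + Δt • N v + Δt • N (v + Δt • N v)‖ := by
      simp only [norm_smul, Real.norm_of_nonneg one_half_pos.le]
    _ ≤ ‖v‖ := by linarith
end

section
/- The third-order SSP Runge–Kutta scheme preserves the strong stability of the forward Euler step: if ‖w + Δt·N(w)‖ ≤ ‖w‖ for every w ∈ E, then one step of the scheme satisfies ‖v_new‖ ≤ ‖v‖ for every v ∈ E. -/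
/-- A nonnegative combination of `v` with a forward Euler step from `w` is bounded by the same
combination of norms, when the Euler step from `w` does not increase the norm. -/
theorem norm_smul_add_eulerStep_le {E : Type*} [SeminormedAddCommGroup E] [NormedSpace ℝ E]
    {N : E → E} {Δt a b : ℝ} (ha : 0 ≤ a) (hb : 0 ≤ b) (v : E) {w : E}
    (hw : ‖w + Δt • N w‖ ≤ ‖w‖) :
    ‖a • v + b • w + (b * Δt) • N w‖ ≤ a * ‖v‖ + b * ‖w‖ := by
  rw [mul_smul, add_assoc, ← smul_add]
  calc ‖a • v + b • (w + Δt • N w)‖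
      ≤ ‖a • v‖ + ‖b • (w + Δt • N w)‖ := norm_add_le _ _
    _ = a * ‖v‖ + b * ‖w + Δt • N w‖ := by
      rw [norm_smul_of_nonneg ha, norm_smul_of_nonneg hb]
    _ ≤ a * ‖v‖ + b * ‖w‖ := by gcongr

/-- The third-order SSP Runge–Kutta scheme preserves the strong stability of the forward
Euler step: if `‖w + Δt·N(w)‖ ≤ ‖w‖` for every `w`, then one step
`v¹ = v + Δt·N(v)`, `v² = (3/4)·v + (1/4)·v¹ + (1/4)·Δt·N(v¹)`,
`v_new = (1/3)·v + (2/3)·v² + (2/3)·Δt·N(v²)` satisfies `‖v_new‖ ≤ ‖v‖`. -/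
theorem ssp3_strong_stability {E : Type*} [NormedAddCommGroup E] [NormedSpace ℝ E]
    (N : E → E) (Δt : ℝ) (hΔt : 0 ≤ Δt)
    (hEuler : ∀ w : E, ‖w + Δt • N w‖ ≤ ‖w‖) :
    ∀ v : E,
      let v1 := v + Δt • N v
      let v2 := (3 / 4 : ℝ) • v + (1 / 4 : ℝ) • v1 + ((1 / 4 : ℝ) * Δt) • N v1
      ‖(1 / 3 : ℝ) • v + (2 / 3 : ℝ) • v2 + ((2 / 3 : ℝ) * Δt) • N v2‖ ≤ ‖v‖ := by
  intro v v1 v2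
  have h1 : ‖v1‖ ≤ ‖v‖ := hEuler v
  have h2 : ‖v2‖ ≤ 3 / 4 * ‖v‖ + 1 / 4 * ‖v1‖ :=
    norm_smul_add_eulerStep_le (by norm_num) (by norm_num) v (hEuler v1)
  have h3 : ‖(1 / 3 : ℝ) • v + (2 / 3 : ℝ) • v2 + ((2 / 3 : ℝ) * Δt) • N v2‖ ≤
      1 / 3 * ‖v‖ + 2 / 3 * ‖v2‖ :=
    norm_smul_add_eulerStep_le (by norm_num) (by norm_num) v (hEuler v2)
  linarith
end

section
/- The third-order SSP Runge–Kutta scheme preserves any convex set that is invariant under the forward Euler step: if C ⊆ E is convex and w + Δt·N(w) ∈ C for every w ∈ C, then for every v ∈ C one step of the scheme satisfies v_new ∈ C. In particular, if the Euler step preserves componentwise non-negativity (taking E = ℝⁿ and C the non-negative orthant), so does the third-order SSP scheme. -/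
/-- A convex set invariant under the forward Euler step contains the convex combinations of one of
its points with an Euler step from another. -/
theorem Convex.add_smul_euler_step_mem {E : Type*} [AddCommGroup E] [Module ℝ E] {C : Set E}
    (hC : Convex ℝ C) {N : E → E} {Δt : ℝ} (hN : ∀ w ∈ C, w + Δt • N w ∈ C) {a b : ℝ}
    (ha : 0 ≤ a) (hb : 0 ≤ b) (hab : a + b = 1) {v w : E} (hv : v ∈ C) (hw : w ∈ C) :
    a • v + b • w + (b * Δt) • N w ∈ C := by
  simpa only [smul_add, smul_smul, add_assoc] using hC hv (hN w hw) ha hb hab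

/-- One step of the third-order SSP Runge–Kutta scheme preserves a convex set invariant under the
forward Euler step. -/
theorem Convex.ssp3_step_mem {E : Type*} [AddCommGroup E] [Module ℝ E] {C : Set E}
    (hC : Convex ℝ C) {N : E → E} {Δt : ℝ} (hN : ∀ w ∈ C, w + Δt • N w ∈ C) {v : E}
    (hv : v ∈ C) :
    (1 / 3 : ℝ) • v +
      (2 / 3 : ℝ) •
        ((3 / 4 : ℝ) • v + (1 / 4 : ℝ) • (v + Δt • N v) +
          ((1 / 4 : ℝ) * Δt) • N (v + Δt • N v)) +
      ((2 / 3 : ℝ) * Δt) •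
        N ((3 / 4 : ℝ) • v + (1 / 4 : ℝ) • (v + Δt • N v) +
          ((1 / 4 : ℝ) * Δt) • N (v + Δt • N v)) ∈ C :=
  hC.add_smul_euler_step_mem hN (by norm_num) (by norm_num) (by norm_num) hv
    (hC.add_smul_euler_step_mem hN (by norm_num) (by norm_num) (by norm_num) hv (hN v hv))


/-- The third-order SSP Runge–Kutta scheme `v¹ = v + Δt·N(v)`,
`v² = (3/4)·v + (1/4)·v¹ + (1/4)·Δt·N(v¹)`, `v_new = (1/3)·v + (2/3)·v² + (2/3)·Δt·N(v²)`
preserves any convex set that is invariant under the forward Euler step; in particular,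
if the Euler step preserves componentwise non-negativity on `ℝⁿ`, so does the scheme. -/
theorem ssp3_convex_invariant :
    (∀ {E : Type*} [AddCommGroup E] [Module ℝ E] (C : Set E), Convex ℝ C →
      ∀ (N : E → E) (Δt : ℝ), 0 ≤ Δt → (∀ w ∈ C, w + Δt • N w ∈ C) →
        ∀ v ∈ C,
          (1 / 3 : ℝ) • v +
            (2 / 3 : ℝ) •
              ((3 / 4 : ℝ) • v + (1 / 4 : ℝ) • (v + Δt • N v) +
                ((1 / 4 : ℝ) * Δt) • N (v + Δt • N v)) +
            ((2 / 3 : ℝ) * Δt) •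
              N ((3 / 4 : ℝ) • v + (1 / 4 : ℝ) • (v + Δt • N v) +
                ((1 / 4 : ℝ) * Δt) • N (v + Δt • N v)) ∈ C) ∧
    (∀ (n : ℕ) (N : (Fin n → ℝ) → Fin n → ℝ) (Δt : ℝ), 0 ≤ Δt →
      (∀ w : Fin n → ℝ, (∀ i, 0 ≤ w i) → ∀ i, 0 ≤ (w + Δt • N w) i) →
        ∀ v : Fin n → ℝ, (∀ i, 0 ≤ v i) →
          ∀ i,
            0 ≤ ((1 / 3 : ℝ) • v +
              (2 / 3 : ℝ) •
                ((3 / 4 : ℝ) • v + (1 / 4 : ℝ) • (v + Δt • N v) +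
                  ((1 / 4 : ℝ) * Δt) • N (v + Δt • N v)) +
              ((2 / 3 : ℝ) * Δt) •
                N ((3 / 4 : ℝ) • v + (1 / 4 : ℝ) • (v + Δt • N v) +
                  ((1 / 4 : ℝ) * Δt) • N (v + Δt • N v))) i) := by
  refine ⟨fun C hC N Δt _ hN v hv => hC.ssp3_step_mem hN hv, fun n N Δt _ hN v hv => ?_⟩
  exact (convex_Ici (𝕜 := ℝ) (0 : Fin n → ℝ)).ssp3_step_mem hN hv
end

section
/- A rotational velocity field with radial density and pressure profiles is a steady solution of the momentum balance provided the radial pressure gradient balances the centripetal force: if g, h, q : ℝ → ℝ are differentiable and 2·q′(s) = g(s)·h(s)² for all s, then the fields ρ(x, y) = g(x² + y²), u(x, y) = h(x² + y²)·(−y, x), p(x, y) = q(x² + y²) satisfy ρ·(u·∇)u + ∇p = 0 at every point (x, y) ∈ ℝ². -/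
/-- The derivative of a radial profile along a coordinate line. -/
theorem hasDerivAt_comp_sq_add {f : ℝ → ℝ} (hf : Differentiable ℝ f) (x c : ℝ) :
    HasDerivAt (fun a => f (a ^ 2 + c)) (deriv f (x ^ 2 + c) * (2 * x)) x := by
  have h := ((hasDerivAt_id x).pow 2).add_const c
  simp only [id, Nat.cast_ofNat, Nat.add_one_sub_one, pow_one, mul_one] at h
  exact (hf (x ^ 2 + c)).hasDerivAt.comp x h

theorem hasDerivAt_comp_add_sq {f : ℝ → ℝ} (hf : Differentiable ℝ f) (y c : ℝ) :
    HasDerivAt (fun b => f (c + b ^ 2)) (deriv f (c + y ^ 2) * (2 * y)) y := by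
  simpa only [add_comm c] using hasDerivAt_comp_sq_add hf y c

/-- A rotational velocity field with radial density and pressure profiles is a steady
solution of the momentum balance provided the radial pressure gradient balances the
centripetal force: if `2·q′(s) = g(s)·h(s)²` for all `s`, then
`ρ(x, y) = g(x² + y²)`, `u(x, y) = h(x² + y²)·(−y, x)`, `p(x, y) = q(x² + y²)` satisfy
`ρ·(u·∇)u + ∇p = 0` componentwise at every point. -/
theorem steady_vortex_momentum_balance (g h q : ℝ → ℝ)
    (hg : Differentiable ℝ g) (hh : Differentiable ℝ h) (hq : Differentiable ℝ q)
    (hbal : ∀ s, 2 * deriv q s = g s * h s ^ 2) (x y : ℝ) :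
    g (x ^ 2 + y ^ 2) *
        ((-y * h (x ^ 2 + y ^ 2)) * deriv (fun a => -y * h (a ^ 2 + y ^ 2)) x +
          (x * h (x ^ 2 + y ^ 2)) * deriv (fun b => -b * h (x ^ 2 + b ^ 2)) y) +
      deriv (fun a => q (a ^ 2 + y ^ 2)) x = 0 ∧
    g (x ^ 2 + y ^ 2) *
        ((-y * h (x ^ 2 + y ^ 2)) * deriv (fun a => a * h (a ^ 2 + y ^ 2)) x +
          (x * h (x ^ 2 + y ^ 2)) * deriv (fun b => x * h (x ^ 2 + b ^ 2)) y) +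
      deriv (fun b => q (x ^ 2 + b ^ 2)) y = 0 := by
  have hx := hasDerivAt_comp_sq_add hh x (y ^ 2)
  have hy := hasDerivAt_comp_add_sq hh y (x ^ 2)
  have hb := hbal (x ^ 2 + y ^ 2)
  rw [(hx.const_mul (-y)).deriv, ((hasDerivAt_id' y).fun_neg.fun_mul hy).deriv,
    (hasDerivAt_comp_sq_add hq x (y ^ 2)).deriv, ((hasDerivAt_id' x).fun_mul hx).deriv,
    (hy.const_mul x).deriv, (hasDerivAt_comp_add_sq hq y (x ^ 2)).deriv]
  constructor
  · linear_combination x * hb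
  · linear_combination y * hb
end
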